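/- arXiv:2002.04262 — 2 statements merged into one kernel-verified Lean document; each statement's English description precedes it below -/
import Mathlib

section
/- Theorem (P_{Z_s∩W} = P_W ∘ P_{Z_s}): Let B ∈ ℝ^{n×m} and let Λ_s ⊆ {1,…,n}×{1,…,m} be an index set of cardinality s such that |B_{ij}| ≥ |B_{kl}| for all (i,j) ∈ Λ_s and (k,l) ∉ Λ_s. Define Q ∈ ℝ^{n×m} by Q_{ij} = min(max(−1, B_{ij}), 1) if (i,j) ∈ Λ_s and Q_{ij} = 0 otherwise. Then Q is feasible, i.e., ‖Q‖₀ ≤ s and −1 ≤ Q_{ij} ≤ 1 for all i,j, and Q minimizes ‖X − B‖_F² over all X ∈ ℝ^{n×m} with ‖X‖₀ ≤ s and −1 ≤ X_{ij} ≤ 1 for all i,j. -/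
open Matrix

open scoped Classical in
/-- `‖B‖₀`, the number of nonzero entries of the matrix `B`. -/
noncomputable def l0norm {n m : ℕ} (B : Matrix (Fin n) (Fin m) ℝ) : ℕ :=
  (Finset.univ.filter fun p : Fin n × Fin m => B p.1 p.2 ≠ 0).card

/-- Clamping is the best approximation in `[-1,1]`. -/
theorem clamp_best (b x : ℝ) (h1 : -1 ≤ x) (h2 : x ≤ 1) :
    (min (max (-1) b) 1 - b) ^ 2 ≤ (x - b) ^ 2 := by
  rcases le_total b (-1) with h | h
  · rw [max_eq_left h, min_eq_left (by norm_num)]; nlinarith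
  · rw [max_eq_right h]
    rcases le_total b 1 with h' | h'
    · rw [min_eq_left h']; nlinarith [sq_nonneg (x - b)]
    · rw [min_eq_right h']; nlinarith

/-- The gain as a function of the absolute value. -/
theorem gain_abs (b : ℝ) :
    b ^ 2 - (min (max (-1) b) 1 - b) ^ 2 = |b| ^ 2 - (min |b| 1 - |b|) ^ 2 := by
  rcases le_total b (-1) with h | h
  · rw [max_eq_left h, min_eq_left (by norm_num), abs_of_nonpos (by linarith),
      min_eq_right (by linarith)]; ring
  · rw [max_eq_right h]
    rcases le_total b 1 with h' | h'
    · rw [min_eq_left h', min_eq_left (abs_le.2 ⟨h, h'⟩), sq_abs]; ring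
    · rw [min_eq_right h', abs_of_nonneg (by linarith), min_eq_right h']

/-- The gain is monotone in the absolute value. -/
theorem gain_mono (a b : ℝ) (h : |a| ≤ |b|) :
    a ^ 2 - (min (max (-1) a) 1 - a) ^ 2 ≤ b ^ 2 - (min (max (-1) b) 1 - b) ^ 2 := by
  rw [gain_abs, gain_abs]
  have ha := abs_nonneg a
  generalize |a| = u at *
  generalize |b| = v at *
  rcases le_total u 1 with h1 | h1 <;> rcases le_total v 1 with h2 | h2 <;>
    simp only [min_eq_left, min_eq_right, h1, h2] <;> nlinarith

/-- `P_{Z_s∩W} = P_W ∘ P_{Z_s}`: if `Λ_s` indexes `s` largest-in-absolute-value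
entries of `B` and `Q = P_W(P_{Z_s}(B))` (clamping the selected entries to `[−1,1]` and zeroing
the rest), then `Q` is feasible for Problem 1's constraint set `Z_s ∩ W` and minimizes
`‖X − B‖_F²` over it. -/
theorem stmt_13 {n m s : ℕ} (hs1 : 1 ≤ s) (hs2 : s ≤ n * m)
    (B : Matrix (Fin n) (Fin m) ℝ)
    (Λs : Finset (Fin n × Fin m)) (hcard : Λs.card = s)
    (hmax : ∀ p ∈ Λs, ∀ q : Fin n × Fin m, q ∉ Λs → |B q.1 q.2| ≤ |B p.1 p.2|)
    (Q : Matrix (Fin n) (Fin m) ℝ)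
    (hQ : ∀ i j, Q i j = if (i, j) ∈ Λs then min (max (-1) (B i j)) 1 else 0) :
    (l0norm Q ≤ s ∧ ∀ i j, -1 ≤ Q i j ∧ Q i j ≤ 1) ∧
    ∀ X : Matrix (Fin n) (Fin m) ℝ,
      l0norm X ≤ s → (∀ i j, -1 ≤ X i j ∧ X i j ≤ 1) →
      (∑ p : Fin n × Fin m, (Q p.1 p.2 - B p.1 p.2) ^ 2)
        ≤ ∑ p : Fin n × Fin m, (X p.1 p.2 - B p.1 p.2) ^ 2 := by
  classical
  have hb : ∀ i j, -1 ≤ Q i j ∧ Q i j ≤ 1 := by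
    intro i j
    rw [hQ]
    split_ifs
    · exact ⟨le_min (le_max_left _ _) (by norm_num), min_le_right _ _⟩
    · norm_num
  refine ⟨⟨?_, hb⟩, ?_⟩
  · unfold l0norm
    rw [← hcard]
    apply Finset.card_le_card
    intro p hp
    by_contra hn
    simp [hQ, hn] at hp
  · intro X hX hXb
    obtain ⟨p0, hp0, hmin⟩ := Finset.exists_min_image Λs (fun p => |B p.1 p.2|)
      (Finset.card_pos.1 (by omega))
    obtain ⟨c, hc⟩ : ∃ c, c = B p0.1 p0.2 ^ 2
      - (min (max (-1) (B p0.1 p0.2)) 1 - B p0.1 p0.2) ^ 2 := ⟨_, rfl⟩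
    have hc0 : 0 ≤ c := by
      have := clamp_best (B p0.1 p0.2) 0 (by norm_num) (by norm_num)
      rw [hc]; linarith [this, zero_sub (B p0.1 p0.2), neg_sq (B p0.1 p0.2),
        congrArg (· ^ 2) (zero_sub (B p0.1 p0.2))]
    have key : ∀ p : Fin n × Fin m, (Q p.1 p.2 - B p.1 p.2) ^ 2 ≤ (X p.1 p.2 - B p.1 p.2) ^ 2
        + c * ((if X p.1 p.2 ≠ 0 then 1 else 0) - (if p ∈ Λs then 1 else 0)) := by
      intro p
      have h1 := clamp_best (B p.1 p.2) (X p.1 p.2) (hXb _ _).1 (hXb _ _).2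
      rw [hQ]
      by_cases hp : p ∈ Λs
      · have h2 := gain_mono _ _ (hmin p hp)
        rw [← hc] at h2
        by_cases hx : X p.1 p.2 = 0
        · simp only [hp, hx, if_true, ne_eq, not_true, if_false]; linarith
        · simp only [hp, hx, if_true, ne_eq, not_false_eq_true]; linarith
      · have h2 := gain_mono _ _ (hmax p0 hp0 p hp)
        rw [← hc] at h2
        by_cases hx : X p.1 p.2 = 0
        · simp [hp, hx]
        · simp only [hp, hx, if_true, ne_eq, not_false_eq_true, if_false]; linarith
    have hsum := Finset.sum_le_sum (fun p (_ : p ∈ Finset.univ) => key p)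
    rw [Finset.sum_add_distrib, ← Finset.mul_sum, Finset.sum_sub_distrib, Finset.sum_boole,
      Finset.sum_boole] at hsum
    have hX' : ((Finset.univ.filter fun p : Fin n × Fin m => X p.1 p.2 ≠ 0).card : ℝ) ≤ s := by
      unfold l0norm at hX
      exact_mod_cast (by convert hX)
    have hL : ((Finset.univ.filter fun p : Fin n × Fin m => p ∈ Λs).card : ℝ) = s := by
      simp [hcard]
    rw [hL] at hsum
    have := mul_nonneg hc0 (sub_nonneg.2 hX')
    linarith
end

section
/- Theorem (P_{Z_s∩W_{[0,1]}} = P_{≤1} ∘ P_{Z_s} ∘ P_{≥0}): Let B ∈ ℝ^{n×m}, let Λ̃(B) = {(i,j) : B_{ij} ≥ 0}, and let Γ ⊆ Λ̃(B) be an index set of cardinality min(s, |Λ̃(B)|) such that B_{ij} ≥ B_{kl} for all (i,j) ∈ Γ and (k,l) ∈ Λ̃(B)\Γ. Define Q ∈ ℝ^{n×m} by Q_{ij} = min(B_{ij}, 1) if (i,j) ∈ Γ and Q_{ij} = 0 otherwise. Then Q is feasible, i.e., ‖Q‖₀ ≤ s and 0 ≤ Q_{ij} ≤ 1 for all i,j,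 and Q minimizes ‖X − B‖_F² over all X ∈ ℝ^{n×m} with ‖X‖₀ ≤ s and 0 ≤ X_{ij} ≤ 1 for all i,j. -/
open Matrix

/-- gain obtained from selecting an entry with value `b` -/
noncomputable def gain14 (b : ℝ) : ℝ :=
  2 * b * min (max b 0) 1 - (min (max b 0) 1) ^ 2

lemma gain14_cases (b : ℝ) : (b ≤ 0 ∧ gain14 b = 0) ∨ (0 ≤ b ∧ b ≤ 1 ∧ gain14 b = b ^ 2) ∨
    (1 ≤ b ∧ gain14 b = 2 * b - 1) := by
  unfold gain14
  rcases le_total b 0 with h | h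
  · left; simp [h]
  · rcases le_total b 1 with h1 | h1
    · right; left
      refine ⟨h, h1, ?_⟩
      rw [max_eq_left h, min_eq_left h1]; ring
    · right; right
      refine ⟨h1, ?_⟩
      rw [max_eq_left h, min_eq_right h1]; ring

lemma gain14_nonneg (b : ℝ) : 0 ≤ gain14 b := by
  rcases gain14_cases b with ⟨_, h⟩ | ⟨_, _, h⟩ | ⟨_, h⟩ <;> rw [h]
  · positivity
  · linarith

lemma gain14_mono {a b : ℝ} (hab : a ≤ b) : gain14 a ≤ gain14 b := by
  have hb := gain14_nonneg b
  rcases gain14_cases a with ⟨_, h⟩ | ⟨_, _, h⟩ | ⟨_, h⟩ <;>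
  rcases gain14_cases b with ⟨_, h'⟩ | ⟨_, _, h'⟩ | ⟨_, h'⟩ <;> rw [h, h'] at * <;> nlinarith

lemma gain14_lower (b x : ℝ) (h0 : 0 ≤ x) (h1 : x ≤ 1) : b ^ 2 - gain14 b ≤ (x - b) ^ 2 := by
  rcases gain14_cases b with ⟨_, h⟩ | ⟨_, _, h⟩ | ⟨_, h⟩ <;> rw [h] <;>
    nlinarith [sq_nonneg (x - b), mul_nonneg h0 h0]

lemma gain14_eq (b : ℝ) (h0 : 0 ≤ b) : (min b 1 - b) ^ 2 = b ^ 2 - gain14 b := by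
  unfold gain14; rw [max_eq_left h0]; ring

lemma gain14_sum {ι : Type*} [DecidableEq ι] (S Γ : Finset ι) (f : ι → ℝ) (hf : ∀ i, 0 ≤ f i)
    (hc : S.card ≤ Γ.card) (hm : ∀ p ∈ Γ, ∀ q, q ∉ Γ → f q ≤ f p) :
    ∑ i ∈ S, f i ≤ ∑ i ∈ Γ, f i := by
  have key : ∑ i ∈ S \ Γ, f i ≤ ∑ i ∈ Γ \ S, f i := by
    rcases (S \ Γ).eq_empty_or_nonempty with h | h
    · rw [h]; simpa using Finset.sum_nonneg fun i _ => hf i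
    · obtain ⟨t, ht, hmx⟩ := Finset.exists_max_image _ f h
      have htΓ := (Finset.mem_sdiff.1 ht).2
      have hcc : (S \ Γ).card ≤ (Γ \ S).card := by
        have e1 := Finset.card_sdiff_add_card_inter S Γ
        have e2 := Finset.card_sdiff_add_card_inter Γ S
        rw [Finset.inter_comm] at e2
        omega
      calc ∑ i ∈ S \ Γ, f i ≤ (S \ Γ).card • f t := Finset.sum_le_card_nsmul _ _ _ hmx
        _ ≤ (Γ \ S).card • f t := by
          simp only [nsmul_eq_mul]
          exact mul_le_mul_of_nonneg_right (by exact_mod_cast hcc) (hf t)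
        _ ≤ ∑ i ∈ Γ \ S, f i := Finset.card_nsmul_le_sum _ _ _ fun p hp =>
          hm p (Finset.mem_sdiff.1 hp).1 t htΓ
  have e1 := Finset.sum_inter_add_sum_sdiff S Γ f
  have e2 := Finset.sum_inter_add_sum_sdiff Γ S f
  rw [Finset.inter_comm] at e2
  linarith

open scoped Classical in
/-- `P_{Z_s∩W_{[0,1]}} = P_{≤1} ∘ P_{Z_s} ∘ P_{≥0}`: let `Λ̃(B)` be the set of
indices of nonnegative entries of `B`, and let `Γ ⊆ Λ̃(B)` index `min(s, |Λ̃(B)|)` largest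
entries among them. If `Q = P_{≤1}(P_{Z_s}(P_{≥0}(B)))` (clamping the selected entries to
`[0,1]` from above and zeroing the rest), then `Q` is feasible for the constraint set
`Z_s ∩ W_{[0,1]}` of Problem 2 and minimizes `‖X − B‖_F²` over it. -/
theorem stmt_14 {n m s : ℕ} (hs1 : 1 ≤ s) (hs2 : s ≤ n * m)
    (B : Matrix (Fin n) (Fin m) ℝ)
    (Γ : Finset (Fin n × Fin m))
    (hΓsub : ∀ p ∈ Γ, 0 ≤ B p.1 p.2)
    (hcard : Γ.card =
      min s (Finset.univ.filter fun p : Fin n × Fin m => 0 ≤ B p.1 p.2).card)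
    (hmax : ∀ p ∈ Γ, ∀ q : Fin n × Fin m, 0 ≤ B q.1 q.2 → q ∉ Γ →
      B q.1 q.2 ≤ B p.1 p.2)
    (Q : Matrix (Fin n) (Fin m) ℝ)
    (hQ : ∀ i j, Q i j = if (i, j) ∈ Γ then min (B i j) 1 else 0) :
    (l0norm Q ≤ s ∧ ∀ i j, 0 ≤ Q i j ∧ Q i j ≤ 1) ∧
    ∀ X : Matrix (Fin n) (Fin m) ℝ,
      l0norm X ≤ s → (∀ i j, 0 ≤ X i j ∧ X i j ≤ 1) →
      (∑ p : Fin n × Fin m, (Q p.1 p.2 - B p.1 p.2) ^ 2)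
        ≤ ∑ p : Fin n × Fin m, (X p.1 p.2 - B p.1 p.2) ^ 2 := by
  have hg : ∀ p ∈ Γ, ∀ q : Fin n × Fin m, q ∉ Γ →
      gain14 (B q.1 q.2) ≤ gain14 (B p.1 p.2) := by
    intro p hp q hq
    rcases le_total 0 (B q.1 q.2) with h | h
    · exact gain14_mono (hmax p hp q h hq)
    · exact gain14_mono (h.trans (hΓsub p hp))
  refine ⟨⟨?_, ?_⟩, ?_⟩
  · refine le_trans (Finset.card_le_card (t := Γ) ?_) (hcard.le.trans (min_le_left _ _))
    intro p hp
    by_contra hn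
    simp [hQ, hn] at hp
  · intro i j
    rw [hQ]
    split_ifs with h
    · exact ⟨le_min (hΓsub _ h) zero_le_one, min_le_right _ _⟩
    · exact ⟨le_rfl, zero_le_one⟩
  · intro X hX hX01
    set S := Finset.univ.filter fun p : Fin n × Fin m => X p.1 p.2 ≠ 0 with hS
    have hScard : S.card ≤ s := by
      unfold l0norm at hX
      convert hX
    have main : ∑ p ∈ S, gain14 (B p.1 p.2) ≤ ∑ p ∈ Γ, gain14 (B p.1 p.2) := by
      rcases le_total s (Finset.univ.filter fun p : Fin n × Fin m => 0 ≤ B p.1 p.2).card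
        with h | h
      · rw [min_eq_left h] at hcard
        exact gain14_sum S Γ _ (fun _ => gain14_nonneg _) (hcard ▸ hScard) hg
      · rw [min_eq_right h] at hcard
        have hΓ : Γ = Finset.univ.filter fun p : Fin n × Fin m => 0 ≤ B p.1 p.2 :=
          Finset.eq_of_subset_of_card_le (fun p hp => by simpa using hΓsub p hp) hcard.ge
        calc ∑ p ∈ S, gain14 (B p.1 p.2) ≤ ∑ p : Fin n × Fin m, gain14 (B p.1 p.2) :=
              Finset.sum_le_sum_of_subset_of_nonneg (Finset.subset_univ _)
                fun _ _ _ => gain14_nonneg _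
          _ = ∑ p ∈ Γ, gain14 (B p.1 p.2) := by
              symm
              apply Finset.sum_subset (Finset.subset_univ _)
              intro p _ hp
              have hp' : B p.1 p.2 < 0 := by simpa [hΓ] using hp
              simp [gain14, hp'.le]
    have e1 : ∑ p : Fin n × Fin m, (Q p.1 p.2 - B p.1 p.2) ^ 2 =
        ∑ p : Fin n × Fin m, (B p.1 p.2) ^ 2 - ∑ p ∈ Γ, gain14 (B p.1 p.2) := by
      have e0 : ∑ p ∈ Γ, gain14 (B p.1 p.2) =
          ∑ p : Fin n × Fin m, if p ∈ Γ then gain14 (B p.1 p.2) else 0 := by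
        rw [← Finset.sum_filter]; simp
      rw [e0, ← Finset.sum_sub_distrib]
      refine Finset.sum_congr rfl fun p _ => ?_
      rw [hQ]
      split_ifs with h
      · exact gain14_eq _ (hΓsub _ h)
      · ring
    have e2 : ∑ p : Fin n × Fin m, (B p.1 p.2) ^ 2 - ∑ p ∈ S, gain14 (B p.1 p.2) ≤
        ∑ p : Fin n × Fin m, (X p.1 p.2 - B p.1 p.2) ^ 2 := by
      rw [hS, Finset.sum_filter, ← Finset.sum_sub_distrib]
      refine Finset.sum_le_sum fun p _ => ?_
      split_ifs with h
      · exact gain14_lower _ _ (hX01 _ _).1 (hX01 _ _).2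
      · rw [not_not.1 h]; exact le_of_eq (by ring)
    linarith
end
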